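/- Let N ≥ 1 and s be natural numbers with s > 13, and let a, b : Fin s → ZMod N with ∑_j a j = 0 and ∑_j b j = 0 in ZMod N. Let l := |{j : a j = 0}| and k := |{j : b j = 0}|, and set dₐ := (∑_j (−(a j)).val)/N − 1, d₋ₐ := (∑_j (a j).val)/N − 1, d_b := (∑_j (−(b j)).val)/N − 1, d₋_b := (∑_j (b j).val)/N − 1 (all exact integer divisions). If dₐ ≥ 2, d₋ₐ ≥ 2, d_b ≥ 2, d₋_b ≥ 2 and l + k < s, then dₐ·d₋ₐ + d_b·d₋_b > s − 3. -/

import Mathlib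

theorem ZMod.val_neg_add_val_add_ite {N : ℕ} [NeZero N] (x : ZMod N) :
    (-x).val + x.val + N * (if x = 0 then 1 else 0) = N := by
  have := x.val_lt
  rw [ZMod.neg_val]
  split_ifs with h
  · simp [h]
  · omega

theorem ZMod.dvd_sum_val {N : ℕ} [NeZero N] {ι : Type*} (t : Finset ι) (a : ι → ZMod N)
    (ha : ∑ j ∈ t, a j = 0) : N ∣ ∑ j ∈ t, (a j).val := by
  rw [← ZMod.natCast_eq_zero_iff]
  simpa using ha

/-- For a zero-sum family in `ZMod N`, the quotients by `N` of the sums of representatives of the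
family and of its negative add up to the number of nonzero entries. -/
theorem ZMod.sum_val_neg_div_add_sum_val_div {N : ℕ} [NeZero N] {ι : Type*} (t : Finset ι)
    (a : ι → ZMod N) (ha : ∑ j ∈ t, a j = 0) :
    (∑ j ∈ t, (-(a j)).val) / N + (∑ j ∈ t, (a j).val) / N
      + (t.filter (fun j => a j = 0)).card = t.card := by
  obtain ⟨p, hp⟩ := ZMod.dvd_sum_val t (fun j => -(a j)) (by simp [ha])
  obtain ⟨q, hq⟩ := ZMod.dvd_sum_val t a ha
  have hN : 0 < N := Nat.pos_of_neZero N
  rw [hp, hq, Nat.mul_div_cancel_left _ hN, Nat.mul_div_cancel_left _ hN]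
  have key := Finset.sum_congr (rfl : t = t) fun j _ => ZMod.val_neg_add_val_add_ite (a j)
  rw [Finset.sum_add_distrib, Finset.sum_add_distrib, hp, hq, ← Finset.mul_sum,
    ← Finset.card_filter, Finset.sum_const, smul_eq_mul, ← mul_add, ← mul_add,
    mul_comm t.card] at key
  exact Nat.eq_of_mul_eq_mul_left hN key

theorem Nat.two_mul_add_le_mul_add_four {x y : ℕ} (hx : 2 ≤ x) (hy : 2 ≤ y) :
    2 * (x + y) ≤ x * y + 4 := by
  obtain ⟨u, rfl⟩ := Nat.exists_eq_add_of_le hx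
  obtain ⟨v, rfl⟩ := Nat.exists_eq_add_of_le hy
  nlinarith [Nat.zero_le (u * v)]

/-- Arithmetic content of Theorem 3.3: for two row vectors `a b : Fin s → ZMod N` with
zero sums, if the four eigenspace dimensions are all at least 2 and the numbers of zero
entries satisfy `l + k < s`, then for `s > 13` the sum of the two products exceeds `s - 3`. -/
theorem prym_abelian_not_special (N s : ℕ) (hN : 1 ≤ N) (hs : 13 < s)
    (a b : Fin s → ZMod N) (ha : ∑ j, a j = 0) (hb : ∑ j, b j = 0)
    (hda : 2 ≤ (∑ j, (-(a j)).val) / N - 1)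
    (hda' : 2 ≤ (∑ j, (a j).val) / N - 1)
    (hdb : 2 ≤ (∑ j, (-(b j)).val) / N - 1)
    (hdb' : 2 ≤ (∑ j, (b j).val) / N - 1)
    (hlk : (Finset.univ.filter (fun j => a j = 0)).card
            + (Finset.univ.filter (fun j => b j = 0)).card < s) :
    s - 3 < ((∑ j, (-(a j)).val) / N - 1) * ((∑ j, (a j).val) / N - 1)
          + ((∑ j, (-(b j)).val) / N - 1) * ((∑ j, (b j).val) / N - 1) := by
  have : NeZero N := ⟨by omega⟩
  have hA := ZMod.sum_val_neg_div_add_sum_val_div Finset.univ a ha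
  have hB := ZMod.sum_val_neg_div_add_sum_val_div Finset.univ b hb
  rw [Finset.card_univ, Fintype.card_fin] at hA hB
  have := Nat.two_mul_add_le_mul_add_four hda hda'
  have := Nat.two_mul_add_le_mul_add_four hdb hdb'
  omega
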